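/- Let K ≥ 2, let H_k be an m_k × n complex matrix for k ∈ {1,…,K}, with H_1·H_1ᴴ invertible and n > m_1. Let Q̂0, Q̂c, Q̂a be n×n Hermitian PSD matrices, let ξ ∈ (0,1), set ρ := (1−ξ)·Re(trace(Q̂0))/(n − m_1) and E := ρ•(I_n − H_1ᴴ·(H_1·H_1ᴴ)⁻¹·H_1), and define Q̄0 := ξ•Q̂0, Q̄c := Q̂c, Q̄a := Q̂a + E. Then: (i) Q̄0, Q̄c, Q̄a are Hermitian PSD; (ii) Re(trace(Q̄0+Q̄c+Q̄a)) = Re(trace(Q̂0+Q̂c+Q̂a)); (iii) C_b(Q̄c,Q̄a) = C_b(Q̂c,Q̂a); (iv) C_{e,k}(Q̄c,Q̄a) ≤ C_{e,k}(Q̂c,Q̂a) for every k ∈ {2,…,K}; and (v) C_{m,k}(Q̄0,Q̄c,Q̄a) ≤ C_{m,k}(Q̂0,Q̂c,Q̂a) for every k ∈ {1,…,K}. Consequently the secrecy objective satisfies f_s(Q̄c,Q̄a) ≥ f_s(Q̂c,Q̂a). -/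

import Mathlib

open Matrix ComplexOrder

/-- `logdet M = log (Re (det M))`. -/
noncomputable def logdet {N : Type*} [Fintype N] [DecidableEq N] (M : Matrix N N ℂ) : ℝ :=
  Real.log M.det.re

/-- Multicast rate of the receiver with channel `H`:
`C_m = logdet(I + (I + H (Qc+Qa) Hᴴ)⁻¹ (H Q0 Hᴴ))`. -/
noncomputable def Cmk {p n : ℕ} (H : Matrix (Fin p) (Fin n) ℂ)
    (Q0 Qc Qa : Matrix (Fin n) (Fin n) ℂ) : ℝ :=
  logdet (1 + (1 + H * (Qc + Qa) * Hᴴ)⁻¹ * (H * Q0 * Hᴴ))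

/-- Rate of the confidential message at the receiver with channel `H`
(legitimate-link rate `C_b` when `H = H_1`, eavesdropping rate `C_{e,k}` otherwise):
`logdet(I + (I + H Qa Hᴴ)⁻¹ (H Qc Hᴴ))`. -/
noncomputable def Cek {p n : ℕ} (H : Matrix (Fin p) (Fin n) ℂ)
    (Qc Qa : Matrix (Fin n) (Fin n) ℂ) : ℝ :=
  logdet (1 + (1 + H * Qa * Hᴴ)⁻¹ * (H * Qc * Hᴴ))

/-- The secrecy objective `f_s(Qc,Qa) = C_b(Qc,Qa) - max_{2 ≤ k ≤ K} C_{e,k}(Qc,Qa)`,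
where receiver `1` is the index `0` of `Fin K`. -/
noncomputable def fsObj {n K : ℕ} (hK : 2 ≤ K) {p : Fin K → ℕ}
    (H : (k : Fin K) → Matrix (Fin (p k)) (Fin n) ℂ)
    (Qc Qa : Matrix (Fin n) (Fin n) ℂ) : ℝ :=
  Cek (H ⟨0, Nat.lt_of_lt_of_le Nat.zero_lt_two hK⟩) Qc Qa -
    (Finset.univ.erase (⟨0, Nat.lt_of_lt_of_le Nat.zero_lt_two hK⟩ : Fin K)).sup'
      ⟨⟨1, hK⟩, by simp [Finset.mem_erase, Fin.ext_iff]⟩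
      (fun k => Cek (H k) Qc Qa)

lemma aux_decomp {N : Type*} [Fintype N] [DecidableEq N] {P : Matrix N N ℂ} (hP : P.PosSemidef) :
    ∃ B : Matrix N N ℂ, P = Bᴴ * B := by
  open scoped MatrixOrder in
  exact CStarAlgebra.nonneg_iff_eq_star_mul_self.mp hP.nonneg

lemma aux_one_le_det {N : Type*} [Fintype N] [DecidableEq N] {M : Matrix N N ℂ}
    (hM : M.PosSemidef) : 1 ≤ (1 + M).det := by
  have h := hM.1.spectral_theorem
  set U := hM.1.eigenvectorUnitary
  have hU : (U : Matrix N N ℂ) * star (U : Matrix N N ℂ) = 1 := Unitary.mul_star_self_of_mem U.2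
  have hd : (1 + M).det = ∏ i, (1 + (hM.1.eigenvalues i : ℂ)) := by
    have h1 : (1 : Matrix N N ℂ) + M = (U : Matrix N N ℂ) *
        (diagonal fun i => (1 + (hM.1.eigenvalues i : ℂ))) * star (U : Matrix N N ℂ) := by
      have h2 : (diagonal fun i => (1 + (hM.1.eigenvalues i : ℂ))) =
          1 + diagonal (fun i => (hM.1.eigenvalues i : ℂ)) := by
        rw [← diagonal_one, diagonal_add]
      rw [h2, mul_add, add_mul, mul_one, hU]
      congr 1
    rw [h1, det_mul, det_mul, mul_right_comm, ← det_mul, hU, det_one,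
      one_mul, det_diagonal]
  have h3 : (1 : ℝ) ≤ ∏ i, (1 + hM.1.eigenvalues i) :=
    Finset.prod_induction _ (fun x : ℝ => 1 ≤ x) (fun _ _ hx hy => one_le_mul_of_one_le_of_one_le hx hy)
      le_rfl (fun i _ => by have := hM.eigenvalues_nonneg i; linarith)
  rw [hd]
  exact_mod_cast h3

lemma aux_det_factor {N : Type*} [Fintype N] [DecidableEq N] (A B : Matrix N N ℂ) : (1 + A⁻¹ * (Bᴴ * B)).det = (1 + B * A⁻¹ * Bᴴ).det := by
  rw [← mul_assoc, det_one_add_mul_comm, ← mul_assoc]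

lemma aux_det_add {N : Type*} [Fintype N] [DecidableEq N] {A S : Matrix N N ℂ}
    (hA : A.PosDef) : (A + S).det = A.det * (1 + A⁻¹ * S).det := by
  have : IsUnit A.det := hA.det_pos.ne'.isUnit
  rw [← det_mul, mul_add, mul_one, mul_nonsing_inv_cancel_left _ _ this]

lemma aux_det_mono {N : Type*} [Fintype N] [DecidableEq N] {A P : Matrix N N ℂ}
    (hA : A.PosDef) (hP : P.PosSemidef) : A.det ≤ (A + P).det := by
  obtain ⟨B, rfl⟩ := aux_decomp hP
  rw [aux_det_add hA, aux_det_factor A]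
  exact le_mul_of_one_le_right hA.det_pos.le
    (aux_one_le_det (hA.inv.posSemidef.mul_mul_conjTranspose_same B))

lemma aux_inv_sub {N : Type*} [Fintype N] [DecidableEq N] {A P : Matrix N N ℂ}
    (hA : A.PosDef) (hP : P.PosSemidef) : (A⁻¹ - (A + P)⁻¹).PosSemidef := by
  obtain ⟨B, rfl⟩ := aux_decomp hP
  have hu : IsUnit A := hA.isUnit
  have hC : (1 + B * A⁻¹ * Bᴴ).PosDef :=
    PosDef.one.add_posSemidef (hA.inv.posSemidef.mul_mul_conjTranspose_same B)
  have h := Matrix.add_mul_mul_inv_eq_sub A Bᴴ 1 B hu isUnit_one (by simpa using hC.isUnit)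
  rw [mul_one, inv_one] at h
  rw [h, sub_sub_cancel]
  have := hC.inv.posSemidef.mul_mul_conjTranspose_same (A⁻¹ * Bᴴ)
  rw [conjTranspose_mul, conjTranspose_conjTranspose, hA.inv.1.eq] at this
  simpa only [mul_assoc] using this

lemma aux_rate {N : Type*} [Fintype N] [DecidableEq N] {A P S T : Matrix N N ℂ}
    (hA : A.PosDef) (hP : P.PosSemidef) (hS : S.PosSemidef) (hT : T.PosSemidef) :
    logdet (1 + (A + P)⁻¹ * S) ≤ logdet (1 + A⁻¹ * (S + T)) := by
  have hAP := hA.add_posSemidef hP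
  have h0 : 0 < (1 + (A + P)⁻¹ * S).det ∧
      (1 + (A + P)⁻¹ * S).det ≤ (1 + A⁻¹ * S).det := by
    obtain ⟨B, rfl⟩ := aux_decomp hS
    rw [aux_det_factor A, aux_det_factor (A + P)]
    have hX : (1 + B * (A + P)⁻¹ * Bᴴ).PosDef :=
      PosDef.one.add_posSemidef (hAP.inv.posSemidef.mul_mul_conjTranspose_same B)
    refine ⟨hX.det_pos, ?_⟩
    have := aux_det_mono hX ((aux_inv_sub hA hP).mul_mul_conjTranspose_same B)
    convert this using 2
    rw [mul_sub, sub_mul]; abel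
  have h1 : (1 + A⁻¹ * S).det ≤ (1 + A⁻¹ * (S + T)).det := by
    have := aux_det_mono (hA.add_posSemidef hS) hT
    rw [add_assoc, aux_det_add hA, aux_det_add hA (S := S + T)] at this
    exact le_of_mul_le_mul_left this hA.det_pos
  have h2 := h0.2.trans h1
  exact Real.log_le_log (Complex.pos_iff.mp h0.1).1 (Complex.le_def.mp h2).1

lemma aux_smul {N : Type*} [Fintype N] [DecidableEq N] {P : Matrix N N ℂ}
    (hP : P.PosSemidef) {r : ℝ} (hr : 0 ≤ r) : (r • P).PosSemidef := hP.smul hr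

lemma aux_gram {p n : ℕ} (H : Matrix (Fin p) (Fin n) ℂ) {Q : Matrix (Fin n) (Fin n) ℂ}
    (hQ : Q.PosSemidef) : (1 + H * Q * Hᴴ).PosDef :=
  PosDef.one.add_posSemidef (hQ.mul_mul_conjTranspose_same H)

lemma aux_proj {p n : ℕ} (H : Matrix (Fin p) (Fin n) ℂ) (h : IsUnit (H * Hᴴ).det) :
    (1 - Hᴴ * (H * Hᴴ)⁻¹ * H).PosSemidef ∧ H * (1 - Hᴴ * (H * Hᴴ)⁻¹ * H) = 0 ∧
      trace (1 - Hᴴ * (H * Hᴴ)⁻¹ * H) = (n : ℂ) - p := by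
  have h0 : H * (1 - Hᴴ * (H * Hᴴ)⁻¹ * H) = 0 := by
    rw [Matrix.mul_sub, Matrix.mul_one, ← Matrix.mul_assoc, ← Matrix.mul_assoc,
      mul_nonsing_inv _ h, Matrix.one_mul, sub_self]
  have hh : (1 - Hᴴ * (H * Hᴴ)⁻¹ * H)ᴴ = 1 - Hᴴ * (H * Hᴴ)⁻¹ * H := by
    simp [conjTranspose_nonsing_inv, Matrix.mul_assoc]
  refine ⟨?_, h0, ?_⟩
  · have h1 : (1 - Hᴴ * (H * Hᴴ)⁻¹ * H)ᴴ * (1 - Hᴴ * (H * Hᴴ)⁻¹ * H)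
        = 1 - Hᴴ * (H * Hᴴ)⁻¹ * H := by
      rw [hh]
      conv_lhs => rw [Matrix.sub_mul, Matrix.one_mul, Matrix.mul_assoc _ H, h0, Matrix.mul_zero, sub_zero]
    rw [← h1]
    exact posSemidef_conjTranspose_mul_self _
  · rw [trace_sub, Matrix.mul_assoc, trace_mul_comm, Matrix.mul_assoc, nonsing_inv_mul _ h]
    simp

/-- The construction in the proof of Property 1 under Condition 1 (`N_t > N_{r,1}`):
with `ρ = (1-ξ)·tr(Q̂0)/(n - m_1)` and `E = ρ (I - H₁ᴴ (H₁ H₁ᴴ)⁻¹ H₁)`, the new triple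
`(ξ Q̂0, Q̂c, Q̂a + E)` is PSD, uses the same total power, preserves the legitimate rate,
does not increase any eavesdropping rate nor any multicast rate; consequently it does not
decrease the secrecy objective `f_s`. -/
theorem stmt15 {n K : ℕ} (hK : 2 ≤ K) {p : Fin K → ℕ}
    (H : (k : Fin K) → Matrix (Fin (p k)) (Fin n) ℂ)
    (hinv : IsUnit (H ⟨0, Nat.lt_of_lt_of_le Nat.zero_lt_two hK⟩ * (H ⟨0, Nat.lt_of_lt_of_le Nat.zero_lt_two hK⟩)ᴴ).det)
    (hnm : p ⟨0, Nat.lt_of_lt_of_le Nat.zero_lt_two hK⟩ < n)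
    (Q0 Qc Qa : Matrix (Fin n) (Fin n) ℂ)
    (hQ0 : Q0.PosSemidef) (hQc : Qc.PosSemidef) (hQa : Qa.PosSemidef)
    (ξ : ℝ) (hξ : ξ ∈ Set.Ioo (0 : ℝ) 1)
    (ρ : ℝ) (hρ : ρ = (1 - ξ) * (Matrix.trace Q0).re / ((n : ℝ) - (p ⟨0, Nat.lt_of_lt_of_le Nat.zero_lt_two hK⟩ : ℝ)))
    (E : Matrix (Fin n) (Fin n) ℂ)
    (hE : E = ρ • ((1 : Matrix (Fin n) (Fin n) ℂ) -
        (H ⟨0, Nat.lt_of_lt_of_le Nat.zero_lt_two hK⟩)ᴴ * (H ⟨0, Nat.lt_of_lt_of_le Nat.zero_lt_two hK⟩ * (H ⟨0, Nat.lt_of_lt_of_le Nat.zero_lt_two hK⟩)ᴴ)⁻¹ * H ⟨0, Nat.lt_of_lt_of_le Nat.zero_lt_two hK⟩)) :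
    (ξ • Q0).PosSemidef ∧ Qc.PosSemidef ∧ (Qa + E).PosSemidef ∧
      (Matrix.trace (ξ • Q0 + Qc + (Qa + E))).re = (Matrix.trace (Q0 + Qc + Qa)).re ∧
      Cek (H ⟨0, Nat.lt_of_lt_of_le Nat.zero_lt_two hK⟩) Qc (Qa + E) = Cek (H ⟨0, Nat.lt_of_lt_of_le Nat.zero_lt_two hK⟩) Qc Qa ∧
      (∀ k : Fin K, k ≠ ⟨0, Nat.lt_of_lt_of_le Nat.zero_lt_two hK⟩ → Cek (H k) Qc (Qa + E) ≤ Cek (H k) Qc Qa) ∧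
      (∀ k : Fin K, Cmk (H k) (ξ • Q0) Qc (Qa + E) ≤ Cmk (H k) Q0 Qc Qa) ∧
      fsObj hK H Qc Qa ≤ fsObj hK H Qc (Qa + E) := by
  obtain ⟨hξ0, hξ1⟩ := hξ
  obtain ⟨hP, hHP, htr⟩ := aux_proj _ hinv
  have hnp : (0 : ℝ) < (n : ℝ) - (p ⟨0, Nat.lt_of_lt_of_le Nat.zero_lt_two hK⟩ : ℝ) := by
    rw [sub_pos]; exact_mod_cast hnm
  have htr0 : 0 ≤ (Matrix.trace Q0).re := (Complex.le_def.mp hQ0.trace_nonneg).1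
  have hρ0 : 0 ≤ ρ := by
    rw [hρ]
    exact div_nonneg (mul_nonneg (by linarith) htr0) hnp.le
  have hEp : E.PosSemidef := by rw [hE]; exact aux_smul hP hρ0
  have hHE : H ⟨0, Nat.lt_of_lt_of_le Nat.zero_lt_two hK⟩ * E = 0 := by
    rw [hE, Matrix.mul_smul, hHP, smul_zero]
  have hEtr : (trace E).re = (1 - ξ) * (Matrix.trace Q0).re := by
    rw [hE, trace_smul, htr, Complex.smul_re, hρ]
    simp only [Complex.sub_re, Complex.natCast_re, smul_eq_mul]
    field_simp
  have hb : Cek (H ⟨0, Nat.lt_of_lt_of_le Nat.zero_lt_two hK⟩) Qc (Qa + E) =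
      Cek (H ⟨0, Nat.lt_of_lt_of_le Nat.zero_lt_two hK⟩) Qc Qa := by
    unfold Cek
    rw [Matrix.mul_add, hHE, add_zero]
  have he : ∀ k : Fin K, Cek (H k) Qc (Qa + E) ≤ Cek (H k) Qc Qa := by
    intro k
    have := aux_rate (aux_gram (H k) hQa) (hEp.mul_mul_conjTranspose_same (H k))
      (hQc.mul_mul_conjTranspose_same (H k)) PosSemidef.zero
    unfold Cek
    rw [add_zero, add_assoc, ← Matrix.add_mul, ← Matrix.mul_add] at this
    exact this
  refine ⟨aux_smul hQ0 hξ0.le, hQc, hQa.add hEp, ?_, hb, fun k _ => he k, ?_, ?_⟩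
  · simp only [trace_add, trace_smul, Complex.add_re, Complex.smul_re, hEtr, smul_eq_mul]
    ring
  · intro k
    have := aux_rate (aux_gram (H k) (hQc.add hQa)) (hEp.mul_mul_conjTranspose_same (H k))
      ((aux_smul hQ0 hξ0.le).mul_mul_conjTranspose_same (H k))
      ((aux_smul hQ0 (sub_nonneg.mpr hξ1.le)).mul_mul_conjTranspose_same (H k))
    unfold Cmk
    rw [add_assoc 1, ← Matrix.add_mul, ← Matrix.add_mul, ← Matrix.mul_add, ← Matrix.mul_add,
      ← add_smul, add_sub_cancel,
      one_smul, add_assoc Qc] at this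
    exact this
  · unfold fsObj
    rw [hb]
    refine sub_le_sub_left ?_ _
    exact Finset.sup'_mono_fun (fun k _ => he k)
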